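/- There exists ε > 0 such that for all real x with |x| < ε, F(5/24, -11/24; 1/4; 108·x·(x-1)^4 / (x^2+14x+1)^3) = (1 - 22x - 11x^2) · (1+14x+x^2)^(-11/8). -/

import Mathlib

open Real

/-- The Gauss hypergeometric series `F(a,b;c;z) = ∑ ((a)_n (b)_n / ((c)_n n!)) z^n`,
where `(q)_n` is the rising (Pochhammer) factorial. -/
noncomputable def hypgeo (a b c z : ℝ) : ℝ :=
  ∑' n : ℕ, ((∏ i ∈ Finset.range n, (a + i)) * (∏ i ∈ Finset.range n, (b + i)) /
    ((∏ i ∈ Finset.range n, (c + i)) * (Nat.factorial n))) * z ^ n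

open Filter Topology Set

/-- A power series whose coefficients grow at most linearly can be differentiated termwise
on the disk of radius `1/2`. -/
lemma hasDerivAt_tsum_mul_pow {u : ℕ → ℝ} (hu : ∀ n, |u n| ≤ n + 1) {z : ℝ} (hz : |z| < 1 / 2) :
    Summable (fun n => u n * z ^ n) ∧
    Summable (fun n : ℕ => ((n : ℝ) + 1) * u (n + 1) * z ^ n) ∧
    HasDerivAt (fun y => ∑' n, u n * y ^ n)
      (∑' n : ℕ, ((n : ℝ) + 1) * u (n + 1) * z ^ n) z := by
  have hr : ‖(1 / 2 : ℝ)‖ < 1 := by norm_num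
  have hbound : Summable fun n : ℕ => 2 * ((n : ℝ) + 1) * n * (1 / 2 : ℝ) ^ n := by
    have h1 := summable_pow_mul_geometric_of_norm_lt_one 1 hr
    have h2 := summable_pow_mul_geometric_of_norm_lt_one 2 hr
    exact ((h2.add h1).mul_left 2).congr fun n => by ring
  have hterm : ∀ (n : ℕ) (y : ℝ), |y| < 1 / 2 →
      ‖u n * ((n : ℝ) * y ^ (n - 1))‖ ≤ 2 * ((n : ℝ) + 1) * n * (1 / 2 : ℝ) ^ n := by
    intro n y hy
    rcases n with _ | n
    · simp
    · have hp : |y| ^ n ≤ (1 / 2 : ℝ) ^ n := by gcongr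
      have hun := hu (n + 1)
      rw [Real.norm_eq_abs, abs_mul, abs_mul, abs_pow, Nat.abs_cast, Nat.add_sub_cancel, pow_succ]
      calc |u (n + 1)| * (((n + 1 : ℕ) : ℝ) * |y| ^ n)
          ≤ (((n + 1 : ℕ) : ℝ) + 1) * (((n + 1 : ℕ) : ℝ) * (1 / 2) ^ n) := by gcongr
        _ = _ := by ring
  have hmem : ∀ y : ℝ, y ∈ Metric.ball (0 : ℝ) (1 / 2) ↔ |y| < 1 / 2 := fun y => by simp
  have hderiv : ∀ (n : ℕ) (y : ℝ), y ∈ Metric.ball (0 : ℝ) (1 / 2) →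
      HasDerivAt (fun y => u n * y ^ n) (u n * ((n : ℝ) * y ^ (n - 1))) y :=
    fun n y _ => (hasDerivAt_pow n y).const_mul (u n)
  have hzero : Summable fun n => u n * (0 : ℝ) ^ n :=
    summable_of_ne_finset_zero (s := {0}) fun n hn => by
      simp [zero_pow (by simpa using hn : n ≠ 0)]
  have hconn : IsPreconnected (Metric.ball (0 : ℝ) (1 / 2)) :=
    (convex_ball (0 : ℝ) (1 / 2)).isPreconnected
  have hsum := summable_of_summable_hasDerivAt_of_isPreconnected hbound Metric.isOpen_ball hconn
    hderiv (fun n y hy => hterm n y ((hmem y).1 hy)) (by simp) hzero ((hmem z).2 hz)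
  have hd := hasDerivAt_tsum_of_isPreconnected hbound Metric.isOpen_ball hconn
    hderiv (fun n y hy => hterm n y ((hmem y).1 hy)) (by simp) hzero ((hmem z).2 hz)
  have hds : Summable fun n : ℕ => u n * ((n : ℝ) * z ^ (n - 1)) :=
    Summable.of_norm_bounded hbound fun n => hterm n z hz
  have hshift : (fun n : ℕ => u (n + 1) * (((n + 1 : ℕ) : ℝ) * z ^ (n + 1 - 1))) =
      fun n : ℕ => ((n : ℝ) + 1) * u (n + 1) * z ^ n := by
    funext n
    rw [Nat.add_sub_cancel]
    push_cast
    ring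
  refine ⟨hsum, ?_, ?_⟩
  · rw [← hshift]
    exact (summable_nat_add_iff 1).2 hds
  · rw [hds.tsum_eq_zero_add, hshift] at hd
    simpa using hd

lemma HasSum.mul_pow_of_shift {f : ℕ → ℝ} {z S : ℝ} (h0 : f 0 = 0)
    (h : HasSum (fun n => f (n + 1) * z ^ n) S) : HasSum (fun n => f n * z ^ n) (z * S) := by
  rw [← hasSum_nat_add_iff' 1]
  simp only [Finset.range_one, Finset.sum_singleton, h0, zero_mul, sub_zero]
  convert! h.mul_left z using 1
  funext n
  ring

/-- A power series whose coefficients satisfy the hypergeometric recurrence solves the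
hypergeometric differential equation. -/
lemma hypergeometric_ode {u : ℕ → ℝ} {a b c : ℝ} (hu : ∀ n, |u n| ≤ 1)
    (hrec : ∀ n : ℕ, (n + c) * (n + 1) * u (n + 1) = (n + a) * (n + b) * u n) :
    ∃ G H : ℝ → ℝ, ∀ z : ℝ, |z| < 1 / 2 →
      HasDerivAt (fun y => ∑' n, u n * y ^ n) (G z) z ∧ HasDerivAt G (H z) z ∧
      z * (1 - z) * H z = a * b * ∑' n, u n * z ^ n - (c - (a + b + 1) * z) * G z := by
  have hv : ∀ n : ℕ, |((n : ℝ) + 1) * u (n + 1)| ≤ n + 1 := fun n => by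
    rw [abs_mul, abs_of_nonneg (by positivity : (0 : ℝ) ≤ n + 1)]
    exact mul_le_of_le_one_right (by positivity) (hu _)
  refine ⟨fun z => ∑' n : ℕ, ((n : ℝ) + 1) * u (n + 1) * z ^ n,
    fun z => ∑' n : ℕ, ((n : ℝ) + 1) * ((n : ℝ) + 1 + 1) * u (n + 1 + 1) * z ^ n,
    fun z hz => ?_⟩
  obtain ⟨hF, hG, hdF⟩ := hasDerivAt_tsum_mul_pow
    (fun n => (hu n).trans (by simp : (1 : ℝ) ≤ n + 1)) hz
  obtain ⟨-, hH, hdG⟩ := hasDerivAt_tsum_mul_pow hv hz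
  simp only [← mul_assoc, Nat.cast_add, Nat.cast_one] at hH hdG
  refine ⟨hdF, hdG, ?_⟩
  have sF := hF.hasSum
  have sG := hG.hasSum
  have sH := hH.hasSum
  have szG := HasSum.mul_pow_of_shift (f := fun n => (n : ℝ) * u n) (by simp)
    (by simpa using sG)
  have szH := HasSum.mul_pow_of_shift (f := fun n => (n : ℝ) * (n + 1) * u (n + 1)) (by simp)
    (by simpa using sH)
  have szzH := HasSum.mul_pow_of_shift (f := fun n => ((n : ℝ) - 1) * n * u n) (by simp)
    (by simpa using szH)
  have key := (((szH.sub szzH).add (sG.mul_left c)).sub (szG.mul_left (a + b + 1))).sub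
    (sF.mul_left (a * b))
  have hzero := key.unique (by
    convert! hasSum_zero with n
    linear_combination z ^ n * hrec n)
  linear_combination hzero

/-- Uniqueness for a first order linear system with a regular singular point at `0`. -/
lemma eventually_eq_zero_of_singular_system {h k k' A B C D : ℝ → ℝ}
    (hA : ContinuousAt A 0) (hB : ContinuousAt B 0) (hC : ContinuousAt C 0)
    (hD : ContinuousAt D 0) (hC0 : 0 < C 0) (hD0 : 0 < D 0) (h0 : h 0 = 0)
    (hh : ∀ᶠ x in 𝓝 0, HasDerivAt h (A x * k x) x)
    (hk : ∀ᶠ x in 𝓝 0, HasDerivAt k (k' x) x)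
    (hode : ∀ᶠ x in 𝓝 0, x * D x * k' x = B x * h x - C x * k x) :
    ∀ᶠ x in 𝓝 0, h x = 0 := by
  have eA : ∀ᶠ x in 𝓝 0, |A x| < |A 0| + 1 := hA.abs.eventually_lt_const (by simp)
  have eB : ∀ᶠ x in 𝓝 0, |B x| < |B 0| + 1 := hB.abs.eventually_lt_const (by simp)
  have eC : ∀ᶠ x in 𝓝 0, C 0 / 2 < C x := hC.eventually_const_lt (by linarith)
  have eD : ∀ᶠ x in 𝓝 0, 0 < D x := hD.eventually_const_lt hD0
  set α := |A 0| + 1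
  set β := |B 0| + 1
  have hα : 0 < α := by positivity
  have hβ : 0 < β := by positivity
  have esmall : ∀ᶠ x : ℝ in 𝓝 0, β * α * |x| < C 0 / 2 := by
    have : ContinuousAt (fun x : ℝ => β * α * |x|) 0 := by fun_prop
    exact this.eventually_lt_const (by simpa using hC0)
  obtain ⟨r, hr, hall⟩ := Metric.eventually_nhds_iff.1
    (hh.and (hk.and (hode.and (eA.and (eB.and (eC.and (eD.and esmall)))))))
  have hδ : 0 < r / 2 := by positivity
  set δ := r / 2 with hδr
  have hin : ∀ x ∈ Icc (-δ) δ, dist x 0 < r := fun x hx => by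
    rw [Real.dist_eq, sub_zero]
    exact (abs_le.2 hx).trans_lt (by linarith)
  have hcont : ContinuousOn (fun x => |k x|) (Icc (-δ) δ) := fun x hx =>
    (hall (hin x hx)).2.1.continuousAt.abs.continuousWithinAt
  have hzero_mem : (0 : ℝ) ∈ Icc (-δ) δ := by constructor <;> linarith
  obtain ⟨y, hy, hmax⟩ := isCompact_Icc.exists_isMaxOn ⟨0, hzero_mem⟩ hcont
  have hhbound : ∀ x ∈ Icc (-δ) δ, |h x| ≤ α * |k y| * |x| := fun x hx => by
    have := (convex_Icc (-δ) δ).norm_image_sub_le_of_norm_hasDerivWithin_le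
      (f := h) (f' := fun x => A x * k x) (C := α * |k y|)
      (fun t ht => (hall (hin t ht)).1.hasDerivWithinAt)
      (fun t ht => by
        rw [Real.norm_eq_abs, abs_mul]
        have h1 := (hall (hin t ht)).2.2.2.1.le
        have h2 : |k t| ≤ |k y| := hmax ht
        gcongr) hzero_mem hx
    simpa [h0] using this
  have hky : k y = 0 := by
    obtain ⟨-, hky', hodey, -, hBy, hCy, hDy, hsy⟩ := hall (hin y hy)
    have hsq : IsMaxOn (fun x => k x ^ 2) (Icc (-δ) δ) y := fun x hx => by
      simpa using sq_le_sq.2 (hmax hx)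
    have hseg : segment ℝ y 0 ⊆ Icc (-δ) δ := (convex_Icc _ _).segment_subset hy hzero_mem
    have hdir := hsq.localize.hasFDerivWithinAt_nonpos
      (hky'.pow 2).hasFDerivAt.hasFDerivWithinAt
      (sub_mem_posTangentConeAt_of_segment_subset hseg)
    have hdir' : 0 ≤ y * (k y * k' y) := by
      simp at hdir
      linarith
    have hprod : k y * (B y * h y) ≤ β * α * |y| * k y ^ 2 := by
      calc k y * (B y * h y) ≤ |k y * (B y * h y)| := le_abs_self _
        _ = |k y| * (|B y| * |h y|) := by rw [abs_mul, abs_mul]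
        _ ≤ |k y| * (β * (α * |k y| * |y|)) := by
          have := hhbound y hy
          gcongr
        _ = β * α * |y| * |k y| ^ 2 := by ring
        _ = _ := by rw [sq_abs]
    have hpos : 0 ≤ k y * (B y * h y) - C y * k y ^ 2 := by
      have := mul_nonneg hDy.le hdir'
      linear_combination this + k y * hodey
    by_contra hne
    have hk2 : 0 < k y ^ 2 := by positivity
    nlinarith
  filter_upwards [Icc_mem_nhds (by linarith : -δ < 0) hδ] with x hx
  simpa [hky] using hhbound x hx

/-- The coefficients of the Gauss hypergeometric series. -/
noncomputable def hypgeoCoeff (a b c : ℝ) (n : ℕ) : ℝ :=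
  (∏ i ∈ Finset.range n, (a + i)) * (∏ i ∈ Finset.range n, (b + i)) /
    ((∏ i ∈ Finset.range n, (c + i)) * (Nat.factorial n))

lemma hypgeoCoeff_succ {a b c : ℝ} (hc : 0 < c) (n : ℕ) :
    (n + c) * (n + 1) * hypgeoCoeff a b c (n + 1) = (n + a) * (n + b) * hypgeoCoeff a b c n := by
  have hp : (∏ i ∈ Finset.range n, (c + i)) ≠ 0 :=
    Finset.prod_ne_zero_iff.2 fun i _ => by positivity
  have hn : (n.factorial : ℝ) ≠ 0 := by positivity
  have hcn : c + n ≠ 0 := by positivity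
  have hn1 : (n : ℝ) + 1 ≠ 0 := by positivity
  simp only [hypgeoCoeff, Finset.prod_range_succ, Nat.factorial_succ]
  push_cast
  field_simp
  ring

lemma abs_hypgeoCoeff_le_one (n : ℕ) : |hypgeoCoeff (5 / 24) (-11 / 24) (1 / 4) n| ≤ 1 := by
  induction n with
  | zero => simp [hypgeoCoeff]
  | succ n ih =>
    have hrec := hypgeoCoeff_succ (a := 5 / 24) (b := -11 / 24) (c := 1 / 4) (by norm_num) n
    have hpos : (0 : ℝ) < (n + 1 / 4) * (n + 1) := by positivity
    have habs := congrArg abs hrec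
    rw [abs_mul, abs_of_pos hpos, abs_mul] at habs
    have hratio : |((n : ℝ) + 5 / 24) * (n + -11 / 24)| ≤ (n + 1 / 4) * (n + 1) := by
      have hn : (0 : ℝ) ≤ n := n.cast_nonneg
      rw [abs_le]
      constructor <;> nlinarith
    have : (n + 1 / 4) * ((n : ℝ) + 1) * |hypgeoCoeff (5 / 24) (-11 / 24) (1 / 4) (n + 1)| ≤
        (n + 1 / 4) * (n + 1) * 1 := by
      rw [habs]
      gcongr
    exact le_of_mul_le_mul_left this hpos

theorem stmt10 : ∃ ε > 0, ∀ x : ℝ, |x| < ε →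
    hypgeo (5/24) (-11/24) (1/4) (108 * x * (x - 1)^4 / (x^2 + 14*x + 1)^3) =
      (1 - 22*x - 11*x^2) * (1 + 14*x + x^2) ^ ((-11 : ℝ)/8) := by
  obtain ⟨G, H, hGH⟩ := hypergeometric_ode abs_hypgeoCoeff_le_one
    (hypgeoCoeff_succ (a := 5 / 24) (b := -11 / 24) (c := 1 / 4) (by norm_num))
  change ∀ z : ℝ, |z| < 1 / 2 → HasDerivAt (hypgeo (5/24) (-11/24) (1/4)) (G z) z ∧
    HasDerivAt G (H z) z ∧ z * (1 - z) * H z = 5 / 24 * (-11 / 24) *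
      hypgeo (5/24) (-11/24) (1/4) z - (1 / 4 - (5 / 24 + -11 / 24 + 1) * z) * G z at hGH
  set F := hypgeo (5/24) (-11/24) (1/4) with hFdef
  have hF0 : F 0 = 1 := by
    rw [hFdef, hypgeo, tsum_eq_single 0 fun n hn => by simp [hn]]
    simp
  let w : ℝ → ℝ := fun x => 108 * (x - 1) ^ 4 / (x ^ 2 + 14 * x + 1) ^ 3
  let z : ℝ → ℝ := fun x => 108 * x * (x - 1) ^ 4 / (x ^ 2 + 14 * x + 1) ^ 3
  let z' : ℝ → ℝ := fun x =>
    -108 * (x - 1) ^ 3 * (x + 1) * (x ^ 2 - 34 * x + 1) / (x ^ 2 + 14 * x + 1) ^ 4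
  let P : ℝ → ℝ := fun x => (x ^ 2 + 14 * x + 1) ^ ((-11 : ℝ) / 8)
  let P' : ℝ → ℝ := fun x => -11 / 8 * (2 * x + 14) * P x / (x ^ 2 + 14 * x + 1)
  let g : ℝ → ℝ := fun x => (1 - 22 * x - 11 * x ^ 2) * P x
  let N : ℝ → ℝ := fun x => -11 / 144 * (x - 5) * (x ^ 2 + 14 * x + 1) ^ 3
  let N' : ℝ → ℝ := fun x => -11 / 144 *
    ((x ^ 2 + 14 * x + 1) ^ 3 + (x - 5) * (3 * (x ^ 2 + 14 * x + 1) ^ 2 * (2 * x + 14)))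
  let d : ℝ → ℝ := fun x => (x - 1) * (x + 1) * (x ^ 2 - 34 * x + 1)
  let d' : ℝ → ℝ := fun x => 2 * x * (x ^ 2 - 34 * x + 1) + (x ^ 2 - 1) * (2 * x - 34)
  let l : ℝ → ℝ := fun x => N x / d x
  let l' : ℝ → ℝ := fun x => (N' x * d x - N x * d' x) / d x ^ 2
  have eq : ∀ᶠ x : ℝ in 𝓝 0, 0 < x ^ 2 + 14 * x + 1 := by
    have : ContinuousAt (fun x : ℝ => x ^ 2 + 14 * x + 1) 0 := by fun_prop
    exact this.eventually_const_lt (by norm_num)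
  have ed : ∀ᶠ x : ℝ in 𝓝 0, d x ≠ 0 := by
    have : ContinuousAt d 0 := by fun_prop
    exact this.eventually_ne (by norm_num [d])
  have ez : ∀ᶠ x in 𝓝 0, |z x| < 1 / 2 := by
    have : ContinuousAt (fun x => |z x|) 0 := by
      simp only [z]
      fun_prop (disch := norm_num)
    exact this.eventually_lt_const (by simp [z])
  have hlin : ∀ x : ℝ, HasDerivAt (fun x : ℝ => x ^ 2 + 14 * x + 1) (2 * x + 14) x := fun x => by
    simpa using (((hasDerivAt_id x).pow 2).add ((hasDerivAt_id x).const_mul 14)).add_const 1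
  have hlin' : ∀ x : ℝ, HasDerivAt (fun x : ℝ => x ^ 2 - 34 * x + 1) (2 * x - 34) x := fun x => by
    simpa using (((hasDerivAt_id x).pow 2).sub ((hasDerivAt_id x).const_mul 34)).add_const 1
  have hz : ∀ x : ℝ, 0 < x ^ 2 + 14 * x + 1 → HasDerivAt z (z' x) x := fun x hq => by
    have h1 := ((((hasDerivAt_id x).const_mul 108).mul
      (((hasDerivAt_id x).sub_const 1).pow 4)).div ((hlin x).pow 3) (pow_ne_zero 3 hq.ne'))
    refine h1.congr_deriv ?_
    simp only [z', id, Pi.mul_apply, Pi.pow_apply]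
    have hq0 := hq.ne'
    generalize hQ : x ^ 2 + 14 * x + 1 = q at hq0 ⊢
    field_simp
    subst hQ
    push_cast
    ring
  have hP : ∀ x : ℝ, 0 < x ^ 2 + 14 * x + 1 → HasDerivAt P (P' x) x := fun x hq => by
    refine ((hlin x).rpow_const (p := (-11 : ℝ) / 8) (Or.inl hq.ne')).congr_deriv ?_
    simp only [P', P]
    rw [rpow_sub_one hq.ne']
    ring
  have hg : ∀ x : ℝ, 0 < x ^ 2 + 14 * x + 1 → d x ≠ 0 →
      HasDerivAt g (z' x * (P x * l x)) x := fun x hq hd => by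
    have h1 := ((((hasDerivAt_id x).const_mul 22).const_sub 1).sub
      (((hasDerivAt_id x).pow 2).const_mul 11)).mul (hP x hq)
    refine h1.congr_deriv ?_
    simp only [d] at hd
    simp only [z', P', l, N, d, id, Pi.pow_apply, Pi.sub_apply]
    have hq0 := hq.ne'
    obtain ⟨hd12, hd3⟩ := mul_ne_zero_iff.1 hd
    obtain ⟨hd1, hd2⟩ := mul_ne_zero_iff.1 hd12
    generalize hQ : x ^ 2 + 14 * x + 1 = q at hq0 ⊢
    generalize hR : x ^ 2 - 34 * x + 1 = r at hd3 ⊢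
    field_simp
    subst hQ hR
    push_cast
    ring
  have hl : ∀ x : ℝ, d x ≠ 0 → HasDerivAt l (l' x) x := fun x hd => by
    have hN : HasDerivAt N (N' x) x := by
      refine ((((hasDerivAt_id x).sub_const 5).const_mul (-11 / 144)).mul
        ((hlin x).pow 3)).congr_deriv ?_
      simp only [N', id, Pi.pow_apply]
      push_cast
      ring
    have hdd : HasDerivAt d (d' x) x := by
      refine ((((hasDerivAt_id x).sub_const 1).mul ((hasDerivAt_id x).add_const 1)).mul
        (hlin' x)).congr_deriv ?_
      simp only [d', id, Pi.mul_apply]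
      ring
    exact hN.div hdd hd
  have hmain := eventually_eq_zero_of_singular_system
    (h := fun x => F (z x) - g x) (k := fun x => G (z x) - P x * l x)
    (k' := fun x => H (z x) * z' x - (P' x * l x + P x * l' x))
    (A := z') (B := fun x => 5 / 24 * (-11 / 24) * z' x)
    (C := fun x => (1 / 4 - 3 / 4 * z x) * z' x) (D := fun x => w x * (1 - z x))
    (by simp only [z']; fun_prop (disch := norm_num))
    (by simp only [z']; fun_prop (disch := norm_num))
    (by simp only [z', z]; fun_prop (disch := norm_num))
    (by simp only [w, z]; fun_prop (disch := norm_num))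
    (by norm_num [z, z']) (by norm_num [w, z]) (by simp [z, g, P, hF0])
    (by
      filter_upwards [eq, ed, ez] with x hq hd hzx
      refine (((hGH _ hzx).1.comp x (hz x hq)).sub (hg x hq hd)).congr_deriv ?_
      ring)
    (by
      filter_upwards [eq, ed, ez] with x hq hd hzx
      exact ((hGH _ hzx).2.1.comp x (hz x hq)).sub ((hP x hq).mul (hl x hd)))
    (by
      filter_upwards [eq, ed, ez] with x hq hd hzx
      have hode := (hGH _ hzx).2.2
      have hxw : x * w x = z x := by
        simp only [w, z]
        ring
      have hgode : z x * (1 - z x) * (P' x * l x + P x * l' x) =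
          z' x * (5 / 24 * (-11 / 24) * g x - (1 / 4 - 3 / 4 * z x) * (P x * l x)) := by
        simp only [d] at hd
        obtain ⟨hd12, hd3⟩ := mul_ne_zero_iff.1 hd
        obtain ⟨hd1, hd2⟩ := mul_ne_zero_iff.1 hd12
        have hq0 := hq.ne'
        simp only [z, z', P', l, l', N, N', d, d', g]
        generalize hQ : x ^ 2 + 14 * x + 1 = q at hq0 ⊢
        generalize hR : x ^ 2 - 34 * x + 1 = r at hd3 ⊢
        field_simp
        subst hQ hR
        ring
      linear_combination (1 - z x) * (H (z x) * z' x - (P' x * l x + P x * l' x)) * hxw +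
        z' x * hode - hgode)
  obtain ⟨ε, hε, hball⟩ := Metric.eventually_nhds_iff.1 hmain
  refine ⟨ε, hε, fun x hx => ?_⟩
  have hfin := sub_eq_zero.1 (hball (by simpa using hx : dist x 0 < ε))
  simp only [z, g, P] at hfin
  rw [hfin, show 1 + 14 * x + x ^ 2 = x ^ 2 + 14 * x + 1 by ring]
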